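/- Let γ := (1+√5)/2, let η := γ^{3/2}/(4√5) + i·γ^{−3/2}/(4√5) and α := (γ^{−3/2} − 1)/2 + i·(γ^{3/2} − 1)/2 in ℂ. Then for every integer m ≥ 0, ∫₀¹ e^{2πimx} / (4 + 4·cos(2πx) + 2·cos(4πx)) dx = η·α^m + conj(η)·conj(α)^m. -/

import Mathlib

noncomputable section

/-- The golden ratio `γ = (1 + √5)/2`. -/
def gold : ℝ := (1 + Real.sqrt 5) / 2

/-- `η = γ^{3/2}/(4√5) + i·γ^{-3/2}/(4√5)`. -/
def ηc : ℂ :=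
  ((gold ^ ((3 : ℝ) / 2) / (4 * Real.sqrt 5) : ℝ) : ℂ) +
    Complex.I * ((gold ^ (-(3 : ℝ) / 2) / (4 * Real.sqrt 5) : ℝ) : ℂ)

/-- `α = (γ^{-3/2} − 1)/2 + i·(γ^{3/2} − 1)/2`. -/
def αc : ℂ :=
  (((gold ^ (-(3 : ℝ) / 2) - 1) / 2 : ℝ) : ℂ) +
    Complex.I * (((gold ^ ((3 : ℝ) / 2) - 1) / 2 : ℝ) : ℂ)

open Complex in
/-- The Poisson-type kernel `∑ₖ a^|k| zᵏ = (1 - a²) z / ((1 - a z) (z - a))` has `m`-th Fourier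
coefficient `a ^ m`. -/
lemma integral_pow_mul_poisson_kernel (a : ℂ) (ha : ‖a‖ < 1) (m : ℕ) :
    ∫ x in (0 : ℝ)..1, circleMap 0 1 (2 * Real.pi * x) ^ m *
      ((1 - a ^ 2) * circleMap 0 1 (2 * Real.pi * x) /
        ((1 - a * circleMap 0 1 (2 * Real.pi * x)) * (circleMap 0 1 (2 * Real.pi * x) - a)))
      = a ^ m := by
  have hne : ∀ z : ℂ, ‖z‖ ≤ 1 → 1 - a * z ≠ 0 := by
    intro z hz h
    have h1 : ‖a * z‖ = 1 := by rw [← sub_eq_zero.mp h, norm_one]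
    rw [norm_mul] at h1
    nlinarith [norm_nonneg a, norm_nonneg z]
  have hd : DiffContOnCl ℂ (fun z : ℂ => z ^ m * (1 - a ^ 2) / (1 - a * z)) (Metric.ball 0 1) := by
    apply DifferentiableOn.diffContOnCl_ball (U := Metric.closedBall 0 1) _ subset_rfl
    intro z hz
    have hz' := hne z (by simpa using hz)
    exact DifferentiableAt.differentiableWithinAt (by fun_prop (disch := assumption))
  have hc := hd.circleIntegral_sub_inv_smul (w := a) (by simpa using ha)
  have h1 : 1 - a * a ≠ 0 := hne a ha.le
  have hπ : (2 * Real.pi : ℂ) ≠ 0 := by exact_mod_cast Real.two_pi_pos.ne'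
  rw [circleIntegral] at hc
  have hs := intervalIntegral.integral_comp_mul_left (a := 0) (b := 1)
    (fun θ : ℝ => circleMap 0 1 θ ^ m * ((1 - a ^ 2) * circleMap 0 1 θ /
        ((1 - a * circleMap 0 1 θ) * (circleMap 0 1 θ - a)))) Real.two_pi_pos.ne'
  rw [hs, mul_zero, mul_one]
  have hcongr : ∀ θ : ℝ, deriv (circleMap 0 1) θ • ((circleMap 0 1 θ - a)⁻¹ •
      (circleMap 0 1 θ ^ m * (1 - a ^ 2) / (1 - a * circleMap 0 1 θ))) =
      I * (circleMap 0 1 θ ^ m * ((1 - a ^ 2) * circleMap 0 1 θ /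
        ((1 - a * circleMap 0 1 θ) * (circleMap 0 1 θ - a)))) := by
    intro θ
    rw [deriv_circleMap]
    simp only [smul_eq_mul, div_eq_mul_inv, mul_inv]
    ring
  simp_rw [hcongr, intervalIntegral.integral_const_mul] at hc
  have hv : a ^ m * (1 - a ^ 2) / (1 - a * a) = a ^ m := by
    rw [← pow_two] at h1 ⊢
    exact mul_div_cancel_right₀ _ h1
  rw [hv, smul_eq_mul, mul_comm (2 * (Real.pi : ℂ)) I, mul_assoc] at hc
  rw [mul_left_cancel₀ I_ne_zero hc, Complex.real_smul]
  push_cast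
  field_simp

lemma continuous_pow_mul_poisson_kernel (a : ℂ) (ha : ‖a‖ < 1) (m : ℕ) :
    Continuous fun x : ℝ => circleMap 0 1 (2 * Real.pi * x) ^ m *
      ((1 - a ^ 2) * circleMap 0 1 (2 * Real.pi * x) /
        ((1 - a * circleMap 0 1 (2 * Real.pi * x)) * (circleMap 0 1 (2 * Real.pi * x) - a))) := by
  have hz : Continuous fun x : ℝ => circleMap 0 1 (2 * Real.pi * x) :=
    (continuous_circleMap 0 1).comp (by fun_prop)
  refine (hz.pow m).mul ((continuous_const.mul hz).div
    ((continuous_const.sub (continuous_const.mul hz)).mul (hz.sub continuous_const)) fun x => ?_)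
  have hn : ‖circleMap 0 1 (2 * Real.pi * x)‖ = 1 := by simp
  refine mul_ne_zero (fun h => ?_) fun h => ?_
  · have h1 := congrArg norm (sub_eq_zero.mp h)
    rw [norm_mul, hn, norm_one] at h1
    linarith
  · rw [sub_eq_zero.mp h] at hn
    linarith

open Complex in
/-- Partial fraction decomposition of `z² / (z⁴ + 2z³ + 4z² + 2z + 1)` into Poisson-type kernels. -/
lemma inv_eq_add_poisson_kernels {a b e f z : ℂ} (ha : a ^ 2 + (1 + I) * a + 1 = 0)
    (hb : b ^ 2 + (1 - I) * b + 1 = 0) (he : e * (2 * I * (1 - a ^ 2)) = a)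
    (hf : f * (2 * I * (1 - b ^ 2)) = -b) (hz : z ≠ 0)
    (hD : 4 + 2 * (z + z⁻¹) + (z ^ 2 + (z⁻¹) ^ 2) ≠ 0) :
    (4 + 2 * (z + z⁻¹) + (z ^ 2 + (z⁻¹) ^ 2))⁻¹ =
      e * ((1 - a ^ 2) * z / ((1 - a * z) * (z - a))) +
      f * ((1 - b ^ 2) * z / ((1 - b * z) * (z - b))) := by
  have hzi : z * z⁻¹ = 1 := mul_inv_cancel₀ hz
  set y := z⁻¹
  have hfac : 4 + 2 * (z + y) + (z ^ 2 + y ^ 2) = (z + y + 1 + I) * (z + y + 1 - I) := by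
    linear_combination (-2) * hzi + I_sq
  rw [hfac] at hD ⊢
  have hp := left_ne_zero_of_mul hD
  have hm := right_ne_zero_of_mul hD
  have ha0 : a ≠ 0 := by rintro rfl; simp at ha
  have hb0 : b ≠ 0 := by rintro rfl; simp at hb
  have hA : (1 - a * z) * (z - a) = -a * z * (z + y + 1 + I) := by
    linear_combination z * ha + a * hzi
  have hB : (1 - b * z) * (z - b) = -b * z * (z + y + 1 - I) := by
    linear_combination z * hb + b * hzi
  have h2 : (2 * I : ℂ) ≠ 0 := by simp
  have hE : e * ((1 - a ^ 2) * z / ((1 - a * z) * (z - a))) = -(2 * I * (z + y + 1 + I))⁻¹ := by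
    rw [hA, mul_div_assoc', ← inv_neg, div_eq_iff (by simp [ha0, hz, hp]),
      eq_inv_mul_iff_mul_eq₀ (by simp [hp])]
    linear_combination -z * (z + y + 1 + I) * he
  have hF : f * ((1 - b ^ 2) * z / ((1 - b * z) * (z - b))) = (2 * I * (z + y + 1 - I))⁻¹ := by
    rw [hB, mul_div_assoc', div_eq_iff (by simp [hb0, hz, hm]),
      eq_inv_mul_iff_mul_eq₀ (by simp [hm])]
    linear_combination z * (z + y + 1 - I) * hf
  rw [hE, hF]
  have hI := I_ne_zero
  field_simp
  ring

lemma gold_pos : 0 < gold := by unfold gold; positivity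

lemma gold_rpow_mul_rpow_neg : gold ^ ((3 : ℝ) / 2) * gold ^ (-(3 : ℝ) / 2) = 1 := by
  rw [← Real.rpow_add gold_pos]
  norm_num

lemma sq_gold_rpow : (gold ^ ((3 : ℝ) / 2)) ^ 2 = 2 + Real.sqrt 5 := by
  rw [← Real.rpow_natCast, ← Real.rpow_mul gold_pos.le]
  norm_num
  have h5 : Real.sqrt 5 ^ 2 = 5 := Real.sq_sqrt (by norm_num)
  unfold gold
  linear_combination (3 + Real.sqrt 5) / 8 * h5

lemma sq_gold_rpow_neg : (gold ^ (-(3 : ℝ) / 2)) ^ 2 = Real.sqrt 5 - 2 := by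
  have h5 : Real.sqrt 5 ^ 2 = 5 := Real.sq_sqrt (by norm_num)
  have h1 := gold_rpow_mul_rpow_neg
  have h2 := sq_gold_rpow
  set p := gold ^ ((3 : ℝ) / 2)
  set q := gold ^ (-(3 : ℝ) / 2)
  linear_combination (Real.sqrt 5 - 2) * (p * q + 1) * h1 - (Real.sqrt 5 - 2) * q ^ 2 * h2 -
    q ^ 2 * h5

lemma norm_αc_lt_one : ‖αc‖ < 1 := by
  have h5 : Real.sqrt 5 ^ 2 = 5 := Real.sq_sqrt (by norm_num)
  have h2 := sq_gold_rpow
  have h3 := sq_gold_rpow_neg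
  have hp : 0 < gold ^ ((3 : ℝ) / 2) := Real.rpow_pos_of_pos gold_pos _
  have hq : 0 < gold ^ (-(3 : ℝ) / 2) := Real.rpow_pos_of_pos gold_pos _
  have h : ‖αc‖ ^ 2 < 1 := by
    rw [← Complex.normSq_eq_norm_sq, Complex.normSq_apply]
    simp only [αc, Complex.add_re, Complex.add_im, Complex.ofReal_re, Complex.ofReal_im,
      Complex.mul_re, Complex.mul_im, Complex.I_re, Complex.I_im]
    have hs : Real.sqrt 5 < 3 := by nlinarith [Real.sqrt_nonneg 5]
    have hs' := Real.sqrt_nonneg 5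
    have hp2 : Real.sqrt 5 - 1 < gold ^ ((3 : ℝ) / 2) := by nlinarith
    nlinarith
  nlinarith [norm_nonneg αc]

open Complex in
lemma αc_quadratic : αc ^ 2 + (1 + I) * αc + 1 = 0 := by
  have h1 := congrArg ((↑) : ℝ → ℂ) gold_rpow_mul_rpow_neg
  have h2 := congrArg ((↑) : ℝ → ℂ) sq_gold_rpow
  have h3 := congrArg ((↑) : ℝ → ℂ) sq_gold_rpow_neg
  unfold αc
  push_cast at h1 h2 h3 ⊢
  generalize ((gold ^ ((3 : ℝ) / 2) : ℝ) : ℂ) = p at *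
  generalize ((gold ^ (-(3 : ℝ) / 2) : ℝ) : ℂ) = q at *
  linear_combination I / 2 * h1 - h2 / 4 + h3 / 4 + (p ^ 2 - 1) / 4 * I_sq

open Complex in
lemma ηc_mul : ηc * (2 * I * (1 - αc ^ 2)) = αc := by
  have h2 := congrArg ((↑) : ℝ → ℂ) sq_gold_rpow
  have h3 := congrArg ((↑) : ℝ → ℂ) sq_gold_rpow_neg
  have hα := αc_quadratic
  have hs : ((Real.sqrt 5 : ℝ) : ℂ) ≠ 0 := by simp
  have hδ : 2 * αc + 1 + I =
      (gold ^ (-(3 : ℝ) / 2) : ℝ) + I * (gold ^ ((3 : ℝ) / 2) : ℝ) := by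
    unfold αc; push_cast; ring
  have hη : ηc * (2 * I * (2 * αc + 1 + I)) = -1 := by
    rw [hδ]
    unfold ηc
    push_cast at h2 h3 ⊢
    generalize ((gold ^ ((3 : ℝ) / 2) : ℝ) : ℂ) = p at *
    generalize ((gold ^ (-(3 : ℝ) / 2) : ℝ) : ℂ) = q at *
    field_simp
    linear_combination (-2) * h2 - 2 * h3 + (2 * p ^ 2 + 2 * q ^ 2 + 2 * p * q * I) * I_sq
  linear_combination -αc * hη + 2 * I * ηc * hα

lemma four_add_cos_add_cos_two_mul_pos (t : ℝ) : 0 < 4 + 4 * Real.cos t + 2 * Real.cos (2 * t) := by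
  rw [Real.cos_two_mul]
  nlinarith [sq_nonneg (2 * Real.cos t + 1)]

theorem helix_fourier_integral (m : ℕ) :
    (∫ x in (0 : ℝ)..1,
        Complex.exp (2 * (Real.pi : ℂ) * Complex.I * (m : ℂ) * (x : ℂ)) /
          ((4 + 4 * Real.cos (2 * Real.pi * x) + 2 * Real.cos (4 * Real.pi * x) : ℝ) : ℂ))
      = ηc * αc ^ m + (starRingEnd ℂ) ηc * ((starRingEnd ℂ) αc) ^ m := by
  have hn : ‖(starRingEnd ℂ) αc‖ < 1 := by simpa using norm_αc_lt_one
  have hα' := congrArg (starRingEnd ℂ) αc_quadratic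
  have hη' := congrArg (starRingEnd ℂ) ηc_mul
  simp only [map_add, map_mul, map_sub, map_pow, map_one, map_zero, map_ofNat,
    Complex.conj_I] at hα' hη'
  rw [← integral_pow_mul_poisson_kernel αc norm_αc_lt_one m,
    ← integral_pow_mul_poisson_kernel _ hn m, ← intervalIntegral.integral_const_mul,
    ← intervalIntegral.integral_const_mul, ← intervalIntegral.integral_add
      (((continuous_pow_mul_poisson_kernel _ norm_αc_lt_one m).intervalIntegrable _ _).const_mul _)
      (((continuous_pow_mul_poisson_kernel _ hn m).intervalIntegrable _ _).const_mul _)]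
  refine intervalIntegral.integral_congr fun x _ => ?_
  have hexp : Complex.exp (2 * (Real.pi : ℂ) * Complex.I * (m : ℂ) * (x : ℂ)) =
      circleMap 0 1 (2 * Real.pi * x) ^ m := by
    rw [circleMap_zero, Complex.ofReal_one, one_mul, ← Complex.exp_nat_mul]
    congr 1
    push_cast
    ring
  have hz : circleMap 0 1 (2 * Real.pi * x) ≠ 0 := circleMap_ne_center one_ne_zero
  have hD : ((4 + 4 * Real.cos (2 * Real.pi * x) + 2 * Real.cos (4 * Real.pi * x) : ℝ) : ℂ) =
      4 + 2 * (circleMap 0 1 (2 * Real.pi * x) + (circleMap 0 1 (2 * Real.pi * x))⁻¹) +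
        (circleMap 0 1 (2 * Real.pi * x) ^ 2 + ((circleMap 0 1 (2 * Real.pi * x))⁻¹) ^ 2) := by
    rw [show 4 * Real.pi * x = 2 * (2 * Real.pi * x) by ring]
    generalize 2 * Real.pi * x = t
    rw [circleMap_zero, Complex.ofReal_one, one_mul, ← Complex.exp_neg, ← Complex.exp_nat_mul,
      ← Complex.exp_nat_mul]
    push_cast
    simp only [Complex.cos]
    ring_nf
  have hpos := four_add_cos_add_cos_two_mul_pos (2 * Real.pi * x)
  rw [show 2 * (2 * Real.pi * x) = 4 * Real.pi * x by ring] at hpos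
  have hne := Complex.ofReal_ne_zero.mpr hpos.ne'
  rw [hD] at hne
  simp only [hexp, hD]
  rw [div_eq_mul_inv, inv_eq_add_poisson_kernels (b := (starRingEnd ℂ) αc)
    (f := (starRingEnd ℂ) ηc) αc_quadratic (by linear_combination hα') ηc_mul
    (by linear_combination -hη') hz hne]
  ring
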